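/- arXiv:math/0412226 — 2 statements merged into one kernel-verified Lean document; each statement's English description precedes it below -/
import Mathlib

section
/- (⟨Cap⟩ ⊗ id_V) ∘ (id_V ⊗ ⟨Cup⟩) = id_V as K-linear maps V → V (identifying V ⊗ K ≅ V ≅ K ⊗ V). This is the Kauffman-amplitude identity corresponding to the Yetter switchback move, i.e. the source and target of the elementary transition ET5I = [[1,Cup,0][0,Cap,1] ⇒ 1₁] have equal Kauffman amplitudes, as required by the paper's claim that the Kauffman amplitude respects regular isotopy. -/
set_option synthInstance.maxHeartbeats 1000000
set_option maxHeartbeats 1000000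

noncomputable section

open TensorProduct

/-- The ground field `K = ℚ(q)`. -/
abbrev K : Type := RatFunc ℚ

/-- The 2-dimensional `K`-vector space `V` with basis `e 0, e 1`. -/
abbrev V : Type := Fin 2 → K

/-- The indeterminate `q`. -/
noncomputable def q : K := RatFunc.X

/-- The basis vectors `e₀, e₁` of `V`. -/
noncomputable def e : Fin 2 → V := fun i => Pi.single i (1 : K)

/-- The standard basis of `V`. -/
noncomputable def Vbasis : Module.Basis (Fin 2) K V := Pi.basisFun K (Fin 2)

/-- The induced basis `e i ⊗ e j` of `V ⊗ V`. -/
noncomputable def VVbasis : Module.Basis (Fin 2 × Fin 2) K (V ⊗[K] V) :=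
  Vbasis.tensorProduct Vbasis

/-- Kauffman amplitude of `Cup`: `1 ↦ -q·e₀⊗e₁ + q⁻¹·e₁⊗e₀`. -/
noncomputable def Cup : K →ₗ[K] V ⊗[K] V :=
  LinearMap.toSpanSingleton K (V ⊗[K] V)
    ((-q) • (e 0 ⊗ₜ[K] e 1) + q⁻¹ • (e 1 ⊗ₜ[K] e 0))

/-- Kauffman amplitude of `Cap`: `e₀⊗e₀ ↦ 0`, `e₁⊗e₁ ↦ 0`, `e₀⊗e₁ ↦ q`, `e₁⊗e₀ ↦ -q⁻¹`. -/
noncomputable def Cap : V ⊗[K] V →ₗ[K] K :=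
  VVbasis.constr K fun p =>
    if p = (0, 1) then q else if p = (1, 0) then -q⁻¹ else 0

/-- Kauffman amplitude of `NE`. -/
noncomputable def NE : V ⊗[K] V →ₗ[K] V ⊗[K] V :=
  VVbasis.constr K fun p =>
    if p = (0, 0) then q • (e 0 ⊗ₜ[K] e 0)
    else if p = (1, 1) then q • (e 1 ⊗ₜ[K] e 1)
    else if p = (0, 1) then q⁻¹ • (e 1 ⊗ₜ[K] e 0)
    else q⁻¹ • (e 0 ⊗ₜ[K] e 1) + (q - q⁻¹ ^ 3) • (e 1 ⊗ₜ[K] e 0)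

/-- Kauffman amplitude of `NW`. -/
noncomputable def NW : V ⊗[K] V →ₗ[K] V ⊗[K] V :=
  VVbasis.constr K fun p =>
    if p = (0, 0) then q⁻¹ • (e 0 ⊗ₜ[K] e 0)
    else if p = (1, 1) then q⁻¹ • (e 1 ⊗ₜ[K] e 1)
    else if p = (1, 0) then q • (e 0 ⊗ₜ[K] e 1)
    else (q⁻¹ - q ^ 3) • (e 0 ⊗ₜ[K] e 1) + q • (e 1 ⊗ₜ[K] e 0)

theorem q_ne_zero' : q ≠ 0 := RatFunc.X_ne_zero

theorem Cap_e (i j : Fin 2) : Cap (e i ⊗ₜ[K] e j) =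
    if (i, j) = (0, 1) then q else if (i, j) = (1, 0) then -q⁻¹ else 0 := by
  have h : e i ⊗ₜ[K] e j = VVbasis (i, j) := by
    simp only [VVbasis, Module.Basis.tensorProduct_apply, Vbasis, Pi.basisFun_apply, e]
  rw [h, Cap, Module.Basis.constr_basis]

/-- `(⟨Cap⟩ ⊗ id_V) ∘ (id_V ⊗ ⟨Cup⟩) = id_V` (switchback move ET5I). -/
theorem switchback_ET5I :
    (TensorProduct.lid K V).toLinearMap ∘ₗ
        TensorProduct.map Cap (LinearMap.id : V →ₗ[K] V) ∘ₗ
        (TensorProduct.assoc K V V V).symm.toLinearMap ∘ₗ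
        TensorProduct.map (LinearMap.id : V →ₗ[K] V) Cup ∘ₗ
        (TensorProduct.rid K V).symm.toLinearMap
      = (LinearMap.id : V →ₗ[K] V) := by
  apply Vbasis.ext
  intro i
  have hb : Vbasis i = e i := by
    simp only [Vbasis, Pi.basisFun_apply, e]
  rw [hb]
  simp only [LinearMap.comp_apply, LinearEquiv.coe_coe, TensorProduct.rid_symm_apply,
    TensorProduct.map_tmul, LinearMap.id_apply, Cup, LinearMap.toSpanSingleton_apply, one_smul,
    TensorProduct.tmul_add, TensorProduct.tmul_smul, map_add, map_smul,
    TensorProduct.assoc_symm_tmul, TensorProduct.lid_tmul, Cap_e]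
  have hq := q_ne_zero'
  fin_cases i
  · simp [smul_smul, hq]
  · simp [smul_smul, hq]
end
end

section
/- The map ⟨NW⟩ satisfies the Yang–Baxter equation: (⟨NW⟩ ⊗ id_V) ∘ (id_V ⊗ ⟨NW⟩) ∘ (⟨NW⟩ ⊗ id_V) = (id_V ⊗ ⟨NW⟩) ∘ (⟨NW⟩ ⊗ id_V) ∘ (id_V ⊗ ⟨NW⟩) as K-linear maps V ⊗ V ⊗ V → V ⊗ V ⊗ V. This is the Kauffman-amplitude identity for the all-NW flavor of the third Reidemeister move (the elementary transition ET3tmb). -/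
set_option synthInstance.maxHeartbeats 1000000
set_option maxHeartbeats 1000000

noncomputable section

open TensorProduct

/-- `f ⊗ id_V` acting on the first two factors of `(V ⊗ V) ⊗ V`. -/
noncomputable def lowCross (f : V ⊗[K] V →ₗ[K] V ⊗[K] V) :
    (V ⊗[K] V) ⊗[K] V →ₗ[K] (V ⊗[K] V) ⊗[K] V :=
  TensorProduct.map f LinearMap.id

/-- `id_V ⊗ f` acting on the last two factors of `(V ⊗ V) ⊗ V`. -/
noncomputable def highCross (f : V ⊗[K] V →ₗ[K] V ⊗[K] V) :
    (V ⊗[K] V) ⊗[K] V →ₗ[K] (V ⊗[K] V) ⊗[K] V :=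
  (TensorProduct.assoc K V V V).symm.toLinearMap ∘ₗ
    TensorProduct.map LinearMap.id f ∘ₗ (TensorProduct.assoc K V V V).toLinearMap

/-- Action of `R ⊗ id` and `id ⊗ R` on pure tensors, over an arbitrary field. -/
theorem yb_generic {F W : Type*} [Field F] [AddCommGroup W] [Module F W]
    (t : F) (ht : t ≠ 0) (x : Fin 2 → W)
    (R : W ⊗[F] W →ₗ[F] W ⊗[F] W) (L H : (W ⊗[F] W) ⊗[F] W →ₗ[F] (W ⊗[F] W) ⊗[F] W)
    (hL : L = TensorProduct.map R LinearMap.id)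
    (hH : H = (TensorProduct.assoc F W W W).symm.toLinearMap ∘ₗ
      TensorProduct.map LinearMap.id R ∘ₗ (TensorProduct.assoc F W W W).toLinearMap)
    (h00 : R (x 0 ⊗ₜ x 0) = t⁻¹ • (x 0 ⊗ₜ x 0))
    (h11 : R (x 1 ⊗ₜ x 1) = t⁻¹ • (x 1 ⊗ₜ x 1))
    (h10 : R (x 1 ⊗ₜ x 0) = t • (x 0 ⊗ₜ x 1))
    (h01 : R (x 0 ⊗ₜ x 1) = (t⁻¹ - t ^ 3) • (x 0 ⊗ₜ x 1) + t • (x 1 ⊗ₜ x 0))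
    (i j k : Fin 2) :
    L (H (L ((x i ⊗ₜ x j) ⊗ₜ x k))) = H (L (H ((x i ⊗ₜ x j) ⊗ₜ x k))) := by
  have l00 (w : W) : L ((x 0 ⊗ₜ x 0) ⊗ₜ w) = t⁻¹ • ((x 0 ⊗ₜ x 0) ⊗ₜ w) := by
    simp [hL, h00, TensorProduct.smul_tmul']
  have l11 (w : W) : L ((x 1 ⊗ₜ x 1) ⊗ₜ w) = t⁻¹ • ((x 1 ⊗ₜ x 1) ⊗ₜ w) := by
    simp [hL, h11, TensorProduct.smul_tmul']
  have l10 (w : W) : L ((x 1 ⊗ₜ x 0) ⊗ₜ w) = t • ((x 0 ⊗ₜ x 1) ⊗ₜ w) := by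
    simp [hL, h10, TensorProduct.smul_tmul']
  have l01 (w : W) : L ((x 0 ⊗ₜ x 1) ⊗ₜ w) =
      (t⁻¹ - t ^ 3) • ((x 0 ⊗ₜ x 1) ⊗ₜ w) + t • ((x 1 ⊗ₜ x 0) ⊗ₜ w) := by
    rw [hL, TensorProduct.map_tmul, h01, TensorProduct.add_tmul]; rfl
  have r00 (w : W) : H ((w ⊗ₜ x 0) ⊗ₜ x 0) = t⁻¹ • ((w ⊗ₜ x 0) ⊗ₜ x 0) := by
    simp [hH, h00]
  have r11 (w : W) : H ((w ⊗ₜ x 1) ⊗ₜ x 1) = t⁻¹ • ((w ⊗ₜ x 1) ⊗ₜ x 1) := by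
    simp [hH, h11]
  have r10 (w : W) : H ((w ⊗ₜ x 1) ⊗ₜ x 0) = t • ((w ⊗ₜ x 0) ⊗ₜ x 1) := by
    simp [hH, h10]
  have r01 (w : W) : H ((w ⊗ₜ x 0) ⊗ₜ x 1) =
      (t⁻¹ - t ^ 3) • ((w ⊗ₜ x 0) ⊗ₜ x 1) + t • ((w ⊗ₜ x 1) ⊗ₜ x 0) := by
    simp [hH, h01, TensorProduct.tmul_add]
  clear hL hH
  fin_cases i <;> fin_cases j <;> fin_cases k <;>
    simp only [Fin.zero_eta, Fin.mk_one, l00, l11, l10, l01, r00, r11, r10, r01,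
      map_add, map_smul] <;>
    match_scalars <;> field_simp <;> ring

theorem NW_apply (i j : Fin 2) : NW (e i ⊗ₜ[K] e j) =
    if (i, j) = (0, 0) then q⁻¹ • (e 0 ⊗ₜ[K] e 0)
    else if (i, j) = (1, 1) then q⁻¹ • (e 1 ⊗ₜ[K] e 1)
    else if (i, j) = (1, 0) then q • (e 0 ⊗ₜ[K] e 1)
    else (q⁻¹ - q ^ 3) • (e 0 ⊗ₜ[K] e 1) + q • (e 1 ⊗ₜ[K] e 0) := by
  have h : e i ⊗ₜ[K] e j = VVbasis (i, j) := by
    rw [VVbasis, Module.Basis.tensorProduct_apply, Vbasis, Pi.basisFun_apply, Pi.basisFun_apply]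
    rfl
  rw [h, NW, Module.Basis.constr_basis]

/-- Yang–Baxter equation for `⟨NW⟩` (Reidemeister III, flavor ET3tmb). -/
theorem yang_baxter_NW :
    lowCross NW ∘ₗ highCross NW ∘ₗ lowCross NW =
      highCross NW ∘ₗ lowCross NW ∘ₗ highCross NW := by
  refine (VVbasis.tensorProduct Vbasis).ext ?_
  rintro ⟨⟨i, j⟩, k⟩
  have h : (VVbasis.tensorProduct Vbasis) ((i, j), k) = (e i ⊗ₜ[K] e j) ⊗ₜ[K] e k := by
    rw [Module.Basis.tensorProduct_apply, VVbasis, Module.Basis.tensorProduct_apply, Vbasis,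
      Pi.basisFun_apply, Pi.basisFun_apply, Pi.basisFun_apply]
    rfl
  rw [h]
  exact yb_generic q RatFunc.X_ne_zero e NW (lowCross NW) (highCross NW) rfl rfl
    ((NW_apply 0 0).trans (if_pos rfl))
    ((NW_apply 1 1).trans (by rw [if_neg (by decide), if_pos rfl]))
    ((NW_apply 1 0).trans (by rw [if_neg (by decide), if_neg (by decide), if_pos rfl]))
    ((NW_apply 0 1).trans
      (by rw [if_neg (by decide), if_neg (by decide), if_neg (by decide)])) i j k
end
end
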